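/- Suppose witness DAGs G_1 and G_2 are consistent with each other, and each of G_1, G_2 is consistent with a witness DAG G_3. Then the merge G_1 ∨ G_2 is consistent with G_3. -/

import Mathlib

open scoped Classical

namespace LLL

/-- Two bad events are dependent iff their variable sets intersect. -/
def Dep {n : ℕ} {E : Type} (S : E → Finset (Fin n)) (b b' : E) : Prop :=
  (S b ∩ S b').Nonempty

/-- A finite directed graph with nodes labeled by bad events. -/
structure LGraph (E : Type) where
  V : Type
  fin : Fintype V
  label : V → E
  edge : V → V → Prop

attribute [instance] LGraph.fin

namespace LGraph

variable {n : ℕ} {E : Type}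

/-- A labeled digraph is a witness DAG: it is acyclic, any two nodes with
dependent labels are joined by an edge (in one direction), and nodes with
non-dependent labels have no edge. -/
def IsWDag (S : E → Finset (Fin n)) (G : LGraph E) : Prop :=
  (∀ v, ¬ Relation.TransGen G.edge v v) ∧
  (∀ v w, G.edge v w → Dep S (G.label v) (G.label w)) ∧
  (∀ v w : G.V, v ≠ w → Dep S (G.label v) (G.label w) → G.edge v w ∨ G.edge w v)

/-- A node is a sink if it has no outgoing edge. -/
def IsSink (G : LGraph E) (v : G.V) : Prop := ∀ w, ¬ G.edge v w

/-- Induced subgraph on a set of vertices. -/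
noncomputable def induce (G : LGraph E) (s : Set G.V) : LGraph E where
  V := s
  fin := (Set.toFinite s).fintype
  label := fun v => G.label v.1
  edge := fun v w => G.edge v.1 w.1

/-- The set of vertices having a directed path to at least one vertex of `s`. -/
def ReachSet (G : LGraph E) (s : Set G.V) : Set G.V :=
  {u | ∃ v ∈ s, Relation.ReflTransGen G.edge u v}

/-- Isomorphism of labeled digraphs. -/
def LIso (G H : LGraph E) : Prop :=
  ∃ e : G.V ≃ H.V, (∀ v, H.label (e v) = G.label v) ∧
    ∀ v w, H.edge (e v) (e w) ↔ G.edge v w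

/-- `G` is a prefix of `H`: `G` is (isomorphic to) the subgraph of `H` induced
on all vertices having a path to a given set of vertices. -/
def IsPrefix (G H : LGraph E) : Prop :=
  ∃ s : Set H.V, LIso G (H.induce (H.ReachSet s))

/-- The position of node v among the nodes with the same label (the number of
same-labeled nodes strictly preceding it). -/
noncomputable def pos (G : LGraph E) (v : G.V) : ℕ :=
  (Finset.univ.filter fun u => G.label u = G.label v ∧ Relation.TransGen G.edge u v).card

/-- The node v has extended label bk = (B, k). -/
def HasExt (G : LGraph E) (v : G.V) (bk : E × ℕ) : Prop :=
  G.label v = bk.1 ∧ G.pos v = bk.2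

/-- The extended label bk = (B, k) occurs in G. -/
def Occurs (G : LGraph E) (bk : E × ℕ) : Prop := ∃ v, G.HasExt v bk

/-- The number of nodes strictly preceding `v` whose label involves variable `i`. -/
noncomputable def vcount (S : E → Finset (Fin n)) (G : LGraph E) (i : Fin n) (v : G.V) : ℕ :=
  (Finset.univ.filter fun u => i ∈ S (G.label u) ∧ Relation.TransGen G.edge u v).card

/-- Position k of the path G[i] of variable i is occupied by a node labeled b. -/
def VOccurs (S : E → Finset (Fin n)) (G : LGraph E) (i : Fin n) (k : ℕ) (b : E) : Prop :=
  ∃ v, i ∈ S (G.label v) ∧ vcount S G i v = k ∧ G.label v = b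

/-- G[i] is an initial segment of G'[i] (as labeled ordered graphs). -/
def InitSeg (S : E → Finset (Fin n)) (G G' : LGraph E) (i : Fin n) : Prop :=
  ∀ k b, VOccurs S G i k b → VOccurs S G' i k b

/-- Witness DAGs G, G' are consistent: for each variable i, either G[i] is an
initial segment of G'[i] or vice versa. -/
def Consistent (S : E → Finset (Fin n)) (G G' : LGraph E) : Prop :=
  ∀ i : Fin n, InitSeg S G G' i ∨ InitSeg S G' G i

/-- The merge G ∨ G' of two witness DAGs: one node for each extended label
occurring in G or G', with an edge between two extended labels iff G or G' has
an edge between nodes with those extended labels. -/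
noncomputable def merge (G G' : LGraph E) : LGraph E where
  V := {bk : E × ℕ // G.Occurs bk ∨ G'.Occurs bk}
  fin := by
    have hsub : {bk : E × ℕ | G.Occurs bk ∨ G'.Occurs bk} ⊆
        (Set.range fun v : G.V => (G.label v, G.pos v)) ∪
        (Set.range fun v : G'.V => (G'.label v, G'.pos v)) := by
      rintro bk (⟨v, hv1, hv2⟩ | ⟨v, hv1, hv2⟩)
      · exact Or.inl ⟨v, by simp [hv1, hv2]⟩
      · exact Or.inr ⟨v, by simp [hv1, hv2]⟩
    exact (((Set.finite_range _).union (Set.finite_range _)).subset hsub).fintype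
  label := fun bk => bk.1.1
  edge := fun a b =>
    (∃ v w, G.HasExt v a.1 ∧ G.HasExt w b.1 ∧ G.edge v w) ∨
    (∃ v w, G'.HasExt v a.1 ∧ G'.HasExt w b.1 ∧ G'.edge v w)

/-- A witness DAG G is compatible with a resampling table R: for every node v,
the label of v is true on the configuration read off from R. -/
def Compat {Vl : Type} (S : E → Finset (Fin n)) (Ev : E → (Fin n → Vl) → Prop)
    (G : LGraph E) (R : Fin n → ℕ → Vl) : Prop :=
  ∀ v : G.V, Ev (G.label v) (fun i => R i (vcount S G i v))

/-- A witness DAG is collectible to b if b is dependent with the labels of all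
its sink nodes; it is collectible if it is collectible to some bad event. -/
def Collectible (S : E → Finset (Fin n)) (G : LGraph E) : Prop :=
  ∃ b : E, ∀ v, G.IsSink v → Dep S b (G.label v)

end LGraph


section helpers
open Relation
variable {n : ℕ} {E : Type} {S : E → Finset (Fin n)}

theorem LGraph.dep_of {i : Fin n} {b c : E} (hb : i ∈ S b) (hc : i ∈ S c) : Dep S b c :=
  ⟨i, Finset.mem_inter.2 ⟨hb, hc⟩⟩

theorem LGraph.vcount_lt {G : LGraph E} (h : G.IsWDag S) {i : Fin n} {u v : G.V}
    (hu : i ∈ S (G.label u)) (huv : TransGen G.edge u v) :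
    vcount S G i u < vcount S G i v := by
  unfold vcount
  apply Finset.card_lt_card
  rw [Finset.ssubset_iff_of_subset]
  · exact ⟨u, by simp [hu, huv], by simp [h.1 u]⟩
  · intro x hx
    simp only [Finset.mem_filter, Finset.mem_univ, true_and] at hx ⊢
    exact ⟨hx.1, hx.2.trans huv⟩

theorem LGraph.pos_lt {G : LGraph E} (h : G.IsWDag S) {u v : G.V}
    (hl : G.label u = G.label v) (huv : TransGen G.edge u v) :
    G.pos u < G.pos v := by
  unfold pos
  apply Finset.card_lt_card
  rw [Finset.ssubset_iff_of_subset]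
  · exact ⟨u, by simp [hl, huv], by simp [h.1 u]⟩
  · intro x hx
    simp only [Finset.mem_filter, Finset.mem_univ, true_and] at hx ⊢
    exact ⟨hx.1.trans hl, hx.2.trans huv⟩

theorem LGraph.edge_of_lt {G : LGraph E} (h : G.IsWDag S) {i : Fin n} {u v : G.V}
    (hu : i ∈ S (G.label u)) (hv : i ∈ S (G.label v))
    (hlt : vcount S G i u < vcount S G i v) : G.edge u v := by
  have hne : u ≠ v := by rintro rfl; exact lt_irrefl _ hlt
  rcases h.2.2 u v hne (dep_of hu hv) with e | e
  · exact e
  · exact absurd (vcount_lt h hv (TransGen.single e)) (by omega)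

theorem LGraph.vcount_inj {G : LGraph E} (h : G.IsWDag S) {i : Fin n} {u v : G.V}
    (hu : i ∈ S (G.label u)) (hv : i ∈ S (G.label v))
    (he : vcount S G i u = vcount S G i v) : u = v := by
  by_contra hne
  rcases h.2.2 u v hne (dep_of hu hv) with e | e
  · exact absurd (vcount_lt h hu (TransGen.single e)) (by omega)
  · exact absurd (vcount_lt h hv (TransGen.single e)) (by omega)

theorem LGraph.ext_inj {G : LGraph E} (h : G.IsWDag S) {i : Fin n} {u v : G.V}
    (hu : i ∈ S (G.label u)) (hl : G.label u = G.label v)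
    (he : G.pos u = G.pos v) : u = v := by
  by_contra hne
  rcases h.2.2 u v hne (dep_of hu (hl ▸ hu)) with e | e
  · exact absurd (pos_lt h hl (TransGen.single e)) (by omega)
  · exact absurd (pos_lt h hl.symm (TransGen.single e)) (by omega)

theorem LGraph.fill {G : LGraph E} (h : G.IsWDag S) {i : Fin n} {v : G.V}
    (hv : i ∈ S (G.label v)) {k : ℕ} (hk : k ≤ vcount S G i v) :
    ∃ u, i ∈ S (G.label u) ∧ vcount S G i u = k := by
  rcases hk.eq_or_lt with rfl | hk
  · exact ⟨v, hv, rfl⟩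
  let P := Finset.univ.filter fun u => i ∈ S (G.label u) ∧ TransGen G.edge u v
  have himg : P.image (vcount S G i) = Finset.range (vcount S G i v) := by
    apply Finset.eq_of_subset_of_card_le
    · intro x hx
      obtain ⟨u, hu, rfl⟩ := Finset.mem_image.1 hx
      have hu' := (Finset.mem_filter.1 hu).2
      exact Finset.mem_range.2 (vcount_lt h hu'.1 hu'.2)
    · rw [Finset.card_image_of_injOn, Finset.card_range]
      · exact le_refl _
      · intro a ha b hb hab
        have ha' := (Finset.mem_filter.1 (Finset.mem_coe.1 ha)).2
        have hb' := (Finset.mem_filter.1 (Finset.mem_coe.1 hb)).2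
        exact vcount_inj h ha'.1 hb'.1 hab
  have := Finset.mem_range.2 hk
  rw [← himg] at this
  obtain ⟨u, hu, e⟩ := Finset.mem_image.1 this
  exact ⟨u, (Finset.mem_filter.1 hu).2.1, e⟩

theorem LGraph.pos_eq {G : LGraph E} (h : G.IsWDag S) {i : Fin n} {v : G.V}
    (hv : i ∈ S (G.label v)) :
    G.pos v = ((Finset.range (vcount S G i v)).filter
      fun k => VOccurs S G i k (G.label v)).card := by
  unfold pos
  refine Finset.card_bij (fun u _ => vcount S G i u) ?_ ?_ ?_
  · intro u hu
    have hu' := (Finset.mem_filter.1 hu).2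
    have hi : i ∈ S (G.label u) := by rw [hu'.1]; exact hv
    exact Finset.mem_filter.2 ⟨Finset.mem_range.2 (vcount_lt h hi hu'.2), u, hi, rfl, hu'.1⟩
  · intro a ha b hb hab
    have ha' := (Finset.mem_filter.1 ha).2
    have hb' := (Finset.mem_filter.1 hb).2
    exact vcount_inj h (by rw [ha'.1]; exact hv) (by rw [hb'.1]; exact hv) hab
  · intro k hk
    obtain ⟨hk1, u, hi, hc, hl⟩ := Finset.mem_filter.1 hk
    refine ⟨u, Finset.mem_filter.2 ⟨Finset.mem_univ _, hl, ?_⟩, hc⟩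
    exact TransGen.single (edge_of_lt h hi hv (by rw [hc]; exact Finset.mem_range.1 hk1))

/-- matching nodes along an initial segment -/
theorem LGraph.lift_init {G G' : LGraph E} (h : G.IsWDag S) (h' : G'.IsWDag S) {i : Fin n}
    (hs : InitSeg S G G' i) {v : G.V} (hv : i ∈ S (G.label v)) :
    ∃ v' : G'.V, G'.label v' = G.label v ∧ vcount S G' i v' = vcount S G i v ∧
      G'.pos v' = G.pos v := by
  obtain ⟨v', hi, hc, hl⟩ := hs _ _ ⟨v, hv, rfl, rfl⟩
  refine ⟨v', hl, hc, ?_⟩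
  rw [pos_eq h hv, pos_eq h' hi, hc, hl]
  congr 1
  apply Finset.filter_congr
  intro k hk
  refine ⟨fun hk' => ?_, hs _ _⟩
  obtain ⟨u', hu', hcu', hlu'⟩ := hk'
  obtain ⟨u, hu, hcu⟩ := fill h hv (Finset.mem_range.1 hk).le
  obtain ⟨w, hw, hcw, hlw⟩ := hs _ _ ⟨u, hu, rfl, rfl⟩
  have : w = u' := vcount_inj h' hw hu' (by omega)
  subst this
  exact ⟨u, hu, hcu, by rw [← hlw, hlu']⟩

theorem LGraph.lift_cmp {G G' : LGraph E} (h : G.IsWDag S) (h' : G'.IsWDag S) {i : Fin n}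
    (hs : InitSeg S G G' i ∨ InitSeg S G' G i) {v : G.V} (hv : i ∈ S (G.label v))
    {u' : G'.V} (hu' : i ∈ S (G'.label u')) (hle : vcount S G' i u' ≤ vcount S G i v) :
    ∃ u : G.V, G.label u = G'.label u' ∧ vcount S G i u = vcount S G' i u' ∧
      G.pos u = G'.pos u' := by
  rcases hs with hs | hs
  · obtain ⟨u, hu, hc⟩ := fill h hv hle
    obtain ⟨w, hl, hcw, hp⟩ := lift_init h h' hs hu
    have : w = u' := vcount_inj h' (by rw [hl]; exact hu) hu' (by omega)
    subst this
    exact ⟨u, hl.symm, hc, hp.symm⟩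
  · exact lift_init h' h hs hu'

theorem LGraph.vcount_ext {G G' : LGraph E} (h : G.IsWDag S) (h' : G'.IsWDag S) {i : Fin n}
    (hs : InitSeg S G G' i ∨ InitSeg S G' G i) {v : G.V} (hv : i ∈ S (G.label v))
    {v' : G'.V} (hl : G'.label v' = G.label v) (hp : G'.pos v' = G.pos v) :
    vcount S G' i v' = vcount S G i v := by
  have hv' : i ∈ S (G'.label v') := by rw [hl]; exact hv
  rcases le_total (vcount S G' i v') (vcount S G i v) with hle | hle
  · obtain ⟨u, hlu, hcu, hpu⟩ := lift_cmp h h' hs hv hv' hle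
    have : u = v := ext_inj h (i := i) (by rw [hlu]; exact hv') (hlu.trans hl) (hpu.trans hp)
    subst this
    exact hcu.symm
  · obtain ⟨u, hlu, hcu, hpu⟩ := lift_cmp h' h hs.symm hv' hv hle
    have : u = v' := ext_inj h' (i := i) (by rw [hlu]; exact hv) (hlu.trans hl.symm)
      (hpu.trans hp.symm)
    subst this
    exact hcu

theorem LGraph.edge_down {G G' : LGraph E} (h : G.IsWDag S) (h' : G'.IsWDag S)
    (hs : Consistent S G G') {v : G.V} {u' v' : G'.V}
    (hl : G'.label v' = G.label v) (hp : G'.pos v' = G.pos v) (he : G'.edge u' v') :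
    ∃ u : G.V, G.label u = G'.label u' ∧ G.pos u = G'.pos u' ∧ G.edge u v := by
  obtain ⟨i, hi⟩ := h'.2.1 _ _ he
  obtain ⟨hu', hv'⟩ := Finset.mem_inter.1 hi
  have hv : i ∈ S (G.label v) := by rw [← hl]; exact hv'
  have hc := vcount_ext h h' (hs i) hv hl hp
  have hlt := vcount_lt h' hu' (TransGen.single he)
  obtain ⟨u, hlu, hcu, hpu⟩ := lift_cmp h h' (hs i) hv hu' (by omega)
  exact ⟨u, hlu, hpu, edge_of_lt h (by rw [hlu]; exact hu') hv (by omega)⟩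

/-- `M` is like a merge around `G`: extended labels `x`, closed downwards. -/
theorem LGraph.vcount_merge_aux {G M : LGraph E} (h : G.IsWDag S) (q : M.V → ℕ)
    (hq : ∀ a b : M.V, M.label a = M.label b → q a = q b → a = b)
    (hG : ∀ v : G.V, ∃ a : M.V, M.label a = G.label v ∧ q a = G.pos v)
    (hup : ∀ (u v : G.V) (a b : M.V), M.label a = G.label u → q a = G.pos u →
      M.label b = G.label v → q b = G.pos v → G.edge u v → M.edge a b)
    (hdown : ∀ (v : G.V) (a b : M.V), M.label b = G.label v → q b = G.pos v → M.edge a b →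
      ∃ u, M.label a = G.label u ∧ q a = G.pos u ∧ G.edge u v)
    {i : Fin n} {v : G.V} {b : M.V} (hb : M.label b = G.label v) (hqb : q b = G.pos v) :
    vcount S M i b = vcount S G i v := by
  have hdt : ∀ a, TransGen M.edge a b →
      ∃ u, M.label a = G.label u ∧ q a = G.pos u ∧ TransGen G.edge u v := by
    intro a ha
    induction ha using TransGen.head_induction_on with
    | single e =>
      obtain ⟨u, h1, h2, h3⟩ := hdown _ _ _ hb hqb e
      exact ⟨u, h1, h2, TransGen.single h3⟩
    | head e _ ih =>
      obtain ⟨w, h1, h2, h3⟩ := ih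
      obtain ⟨u, h4, h5, h6⟩ := hdown _ _ _ h1 h2 e
      exact ⟨u, h4, h5, TransGen.head h6 h3⟩
  have hut : ∀ u, TransGen G.edge u v → ∀ a, M.label a = G.label u → q a = G.pos u →
      TransGen M.edge a b := by
    intro u hu
    induction hu using TransGen.head_induction_on with
    | single e => intro a h1 h2; exact TransGen.single (hup _ _ _ _ h1 h2 hb hqb e)
    | head e _ ih =>
      intro a h1 h2
      obtain ⟨c, hc1, hc2⟩ := hG _
      exact TransGen.head (hup _ _ _ _ h1 h2 hc1 hc2 e) (ih c hc1 hc2)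
  choose f hf1 hf2 using hG
  symm
  unfold vcount
  refine Finset.card_bij (fun u _ => f u) ?_ ?_ ?_
  · intro u hu
    have hu' := (Finset.mem_filter.1 hu).2
    exact Finset.mem_filter.2 ⟨Finset.mem_univ _, by rw [hf1]; exact hu'.1,
      hut u hu'.2 _ (hf1 u) (hf2 u)⟩
  · intro x hx y hy hxy
    have hx' := (Finset.mem_filter.1 hx).2
    exact ext_inj h hx'.1 (by rw [← hf1, ← hf1, hxy]) (by rw [← hf2, ← hf2, hxy])
  · intro a ha
    have ha' := (Finset.mem_filter.1 ha).2
    obtain ⟨u, h1, h2, h3⟩ := hdt a ha'.2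
    exact ⟨u, Finset.mem_filter.2 ⟨Finset.mem_univ _, by rw [← h1]; exact ha'.1, h3⟩,
      hq _ _ ((hf1 u).trans h1.symm) ((hf2 u).trans h2.symm)⟩

theorem LGraph.edge_self {G : LGraph E} (h : G.IsWDag S) {v u' v' : G.V}
    (hl : G.label v' = G.label v) (hp : G.pos v' = G.pos v) (he : G.edge u' v') :
    ∃ u : G.V, G.label u = G.label u' ∧ G.pos u = G.pos u' ∧ G.edge u v := by
  obtain ⟨i, hi⟩ := h.2.1 _ _ he
  have := ext_inj h (Finset.mem_inter.1 hi).2 hl hp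
  subst this
  exact ⟨u', rfl, rfl, he⟩

theorem LGraph.vcount_merge_left {G G' : LGraph E} (h : G.IsWDag S) (h' : G'.IsWDag S)
    (hs : Consistent S G G') {i : Fin n} {v : G.V} {b : (G.merge G').V}
    (hb : G.HasExt v b.1) : vcount S (G.merge G') i b = vcount S G i v := by
  refine vcount_merge_aux (M := G.merge G') h (fun a => a.1.2) ?_ ?_ ?_ ?_ hb.1.symm hb.2.symm
  · intro a b h1 h2; exact Subtype.ext (Prod.ext h1 h2)
  · intro v; exact ⟨⟨(G.label v, G.pos v), Or.inl ⟨v, rfl, rfl⟩⟩, rfl, rfl⟩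
  · intro u v a b h1 h2 h3 h4 e
    exact Or.inl ⟨u, v, ⟨h1.symm, h2.symm⟩, ⟨h3.symm, h4.symm⟩, e⟩
  · rintro v a b h1 h2 (⟨x, y, hx, hy, e⟩ | ⟨x, y, hx, hy, e⟩)
    · obtain ⟨u, k1, k2, k3⟩ := edge_self h (hy.1.trans h1) (hy.2.trans h2) e
      exact ⟨u, (k1.trans hx.1).symm, (k2.trans hx.2).symm, k3⟩
    · obtain ⟨u, k1, k2, k3⟩ := edge_down h h' hs (hy.1.trans h1) (hy.2.trans h2) e
      exact ⟨u, (k1.trans hx.1).symm, (k2.trans hx.2).symm, k3⟩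

theorem LGraph.vcount_merge_right {G G' : LGraph E} (h : G.IsWDag S) (h' : G'.IsWDag S)
    (hs : Consistent S G G') {i : Fin n} {v : G'.V} {b : (G.merge G').V}
    (hb : G'.HasExt v b.1) : vcount S (G.merge G') i b = vcount S G' i v := by
  refine vcount_merge_aux (M := G.merge G') h' (fun a => a.1.2) ?_ ?_ ?_ ?_ hb.1.symm hb.2.symm
  · intro a b h1 h2; exact Subtype.ext (Prod.ext h1 h2)
  · intro v; exact ⟨⟨(G'.label v, G'.pos v), Or.inr ⟨v, rfl, rfl⟩⟩, rfl, rfl⟩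
  · intro u v a b h1 h2 h3 h4 e
    exact Or.inr ⟨u, v, ⟨h1.symm, h2.symm⟩, ⟨h3.symm, h4.symm⟩, e⟩
  · rintro v a b h1 h2 (⟨x, y, hx, hy, e⟩ | ⟨x, y, hx, hy, e⟩)
    · obtain ⟨u, k1, k2, k3⟩ := edge_down h' h (fun i => (hs i).symm)
        (hy.1.trans h1) (hy.2.trans h2) e
      exact ⟨u, (k1.trans hx.1).symm, (k2.trans hx.2).symm, k3⟩
    · obtain ⟨u, k1, k2, k3⟩ := edge_self h' (hy.1.trans h1) (hy.2.trans h2) e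
      exact ⟨u, (k1.trans hx.1).symm, (k2.trans hx.2).symm, k3⟩

theorem LGraph.voccurs_merge {G G' : LGraph E} (h : G.IsWDag S) (h' : G'.IsWDag S)
    (hs : Consistent S G G') (i : Fin n) (k : ℕ) (b : E) :
    VOccurs S (G.merge G') i k b ↔ VOccurs S G i k b ∨ VOccurs S G' i k b := by
  constructor
  · rintro ⟨a, hi, hc, hl⟩
    rcases a.2 with ⟨v, hv⟩ | ⟨v, hv⟩
    · exact Or.inl ⟨v, by rw [hv.1]; exact hi,
        by rw [← vcount_merge_left h h' hs hv]; exact hc, hv.1.trans hl⟩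
    · exact Or.inr ⟨v, by rw [hv.1]; exact hi,
        by rw [← vcount_merge_right h h' hs hv]; exact hc, hv.1.trans hl⟩
  · rintro (⟨v, hi, hc, hl⟩ | ⟨v, hi, hc, hl⟩)
    · exact ⟨⟨(G.label v, G.pos v), Or.inl ⟨v, rfl, rfl⟩⟩, hi,
        (vcount_merge_left h h' hs ⟨rfl, rfl⟩).trans hc, hl⟩
    · exact ⟨⟨(G'.label v, G'.pos v), Or.inr ⟨v, rfl, rfl⟩⟩, hi,
        (vcount_merge_right h h' hs ⟨rfl, rfl⟩).trans hc, hl⟩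

end helpers

/-- If G₁ and G₂ are consistent with each other and each is
consistent with G₃, then G₁ ∨ G₂ is consistent with G₃. -/
theorem stmt16 {n : ℕ} {E : Type} (S : E → Finset (Fin n))
    (G₁ G₂ G₃ : LGraph E)
    (h1 : G₁.IsWDag S) (h2 : G₂.IsWDag S) (h3 : G₃.IsWDag S)
    (h12 : LGraph.Consistent S G₁ G₂)
    (h13 : LGraph.Consistent S G₁ G₃) (h23 : LGraph.Consistent S G₂ G₃) :
    LGraph.Consistent S (G₁.merge G₂) G₃ := by
  intro i
  have hm := LGraph.voccurs_merge h1 h2 h12 i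
  rcases h12 i with hs | hs
  · have hm' : ∀ k b, LGraph.VOccurs S (G₁.merge G₂) i k b ↔ LGraph.VOccurs S G₂ i k b :=
      fun k b => (hm k b).trans ⟨fun h => h.elim (hs k b) id, Or.inr⟩
    exact (h23 i).imp (fun h k b x => h k b ((hm' k b).1 x))
      (fun h k b x => (hm' k b).2 (h k b x))
  · have hm' : ∀ k b, LGraph.VOccurs S (G₁.merge G₂) i k b ↔ LGraph.VOccurs S G₁ i k b :=
      fun k b => (hm k b).trans ⟨fun h => h.elim id (hs k b), Or.inl⟩
    exact (h13 i).imp (fun h k b x => h k b ((hm' k b).1 x))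
      (fun h k b x => (hm' k b).2 (h k b x))

end LLL
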